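/- arXiv:1909.11304 — 2 statements merged into one kernel-verified Lean document; each statement's English description precedes it below -/
import Mathlib

section
/- Let x, x' be fixed vectors in ℝ^{D_in}. For each positive integer n, let Θ_n = Θ_θ(x,x') be the Neural Tangent Kernel of the one-hidden-layer linear network of width n, f_θ(x) = n^{-1/2} Σ_{i=1}^n V_i (Σ_α U_{iα} x_α), at a random standard Gaussian initialization θ. Then Θ_n converges in probability to 2⟨x,x'⟩ as n → ∞: for every ε > 0, P(|Θ_n − 2⟨x,x'⟩| > ε) → 0 as n → ∞. -/
open MeasureTheory ProbabilityTheory Filter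

/-- The standard Gaussian measure on `ι → ℝ`: all coordinates are independent `N(0,1)`. -/
noncomputable def stdGaussian (ι : Type*) [Fintype ι] : Measure (ι → ℝ) :=
  Measure.pi fun _ => gaussianReal 0 1

/-- The one-hidden-layer linear network of width `n`:
`f_θ(x) = n^{-1/2} Σ_i V_i (Σ_α U_{iα} x_α)`. -/
noncomputable def net1 (n D : ℕ) (θ : (Fin n ⊕ Fin n × Fin D) → ℝ) (x : Fin D → ℝ) : ℝ :=
  ((n : ℝ) ^ (-(1 / 2 : ℝ))) *
    ∑ i : Fin n, θ (Sum.inl i) * ∑ α : Fin D, θ (Sum.inr (i, α)) * x α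

/-- The Neural Tangent Kernel `Θ_θ(x,x') = Σ_μ (∂f_θ(x)/∂θ^μ)(∂f_θ(x')/∂θ^μ)`, the sum
running over all parameters `μ`. -/
noncomputable def ntk1 (n D : ℕ) (θ : (Fin n ⊕ Fin n × Fin D) → ℝ) (x x' : Fin D → ℝ) : ℝ :=
  ∑ μ : Fin n ⊕ Fin n × Fin D,
    fderiv ℝ (fun ψ => net1 n D ψ x) θ (Pi.single μ 1) *
      fderiv ℝ (fun ψ => net1 n D ψ x') θ (Pi.single μ 1)

lemma net1_fderiv (n D : ℕ) (θ : (Fin n ⊕ Fin n × Fin D) → ℝ) (x : Fin D → ℝ)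
    (v : (Fin n ⊕ Fin n × Fin D) → ℝ) :
    fderiv ℝ (fun ψ => net1 n D ψ x) θ v = ((n : ℝ) ^ (-(1 / 2 : ℝ))) *
      ∑ i : Fin n, (θ (Sum.inl i) * ∑ α : Fin D, v (Sum.inr (i, α)) * x α
        + v (Sum.inl i) * ∑ α : Fin D, θ (Sum.inr (i, α)) * x α) := by
  have h1 : ∀ μ : Fin n ⊕ Fin n × Fin D, HasFDerivAt
      (fun ψ : (Fin n ⊕ Fin n × Fin D) → ℝ => ψ μ)
      (ContinuousLinearMap.proj (R := ℝ) (φ := fun _ => ℝ) μ) θ := fun μ =>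
    (ContinuousLinearMap.proj (R := ℝ) (φ := fun _ => ℝ) μ).hasFDerivAt
  have h2 : HasFDerivAt (fun ψ => net1 n D ψ x) _ θ :=
    HasFDerivAt.const_mul (HasFDerivAt.fun_sum (u := Finset.univ) fun i _ =>
      (h1 (Sum.inl i)).mul (HasFDerivAt.fun_sum (u := Finset.univ) fun α _ =>
        (h1 (Sum.inr (i, α))).mul_const (x α))) ((n : ℝ) ^ (-(1 / 2 : ℝ)))
  rw [h2.fderiv]
  simp [mul_comm]

lemma ntk1_eq (n D : ℕ) (θ : (Fin n ⊕ Fin n × Fin D) → ℝ) (x x' : Fin D → ℝ) :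
    ntk1 n D θ x x' = (n : ℝ)⁻¹ * ∑ i : Fin n,
      ((∑ α, θ (Sum.inr (i, α)) * x α) * (∑ α, θ (Sum.inr (i, α)) * x' α)
        + θ (Sum.inl i) ^ 2 * ∑ α, x α * x' α) := by
  have hn : ((n : ℝ) ^ (-(1 / 2 : ℝ))) * ((n : ℝ) ^ (-(1 / 2 : ℝ))) = (n : ℝ)⁻¹ := by
    rw [Real.rpow_neg (by positivity), ← Real.sqrt_eq_rpow, ← mul_inv,
      Real.mul_self_sqrt (by positivity)]
  have hl : ∀ (y : Fin D → ℝ) (j : Fin n), fderiv ℝ (fun ψ => net1 n D ψ y) θ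
      (Pi.single (Sum.inl j) 1) = ((n : ℝ) ^ (-(1 / 2 : ℝ))) * 
        ∑ α : Fin D, θ (Sum.inr (j, α)) * y α := by
    intro y j
    rw [net1_fderiv]
    congr 1
    rw [Finset.sum_eq_single j]
    · simp
    · intro b _ hb
      simp [Pi.single_apply, hb]
    · simp
  have hr : ∀ (y : Fin D → ℝ) (j : Fin n) (β : Fin D), fderiv ℝ (fun ψ => net1 n D ψ y) θ
      (Pi.single (Sum.inr (j, β)) 1) = ((n : ℝ) ^ (-(1 / 2 : ℝ))) * 
        (θ (Sum.inl j) * y β) := by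
    intro y j β
    rw [net1_fderiv]
    congr 1
    rw [Finset.sum_eq_single j]
    · simp [Pi.single_apply]
    · intro b _ hb
      simp [Pi.single_apply, hb]
    · simp
  unfold ntk1
  rw [Fintype.sum_sum_type, Fintype.sum_prod_type, ← Finset.sum_add_distrib, Finset.mul_sum]
  refine Finset.sum_congr rfl fun i _ => ?_
  simp only [hl, hr]
  rw [mul_add, ← hn]
  congr 1
  · ring
  · rw [← mul_assoc, Finset.mul_sum]
    refine Finset.sum_congr rfl fun β _ => ?_
    ring

section aux
variable {ι : Type*} [Fintype ι]

instance stdG_prob : IsProbabilityMeasure (_root_.stdGaussian ι) := by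
  unfold _root_.stdGaussian; infer_instance

lemma stdG_eval (a : ι) :
    MeasurePreserving (fun w : ι → ℝ => w a) (_root_.stdGaussian ι) (gaussianReal 0 1) := 
  measurePreserving_eval (fun _ : ι => gaussianReal 0 1) a

lemma stdG_indep : iIndepFun (fun (a : ι) (w : ι → ℝ) => w a) (_root_.stdGaussian ι) := 
  iIndepFun_pi (μ := fun _ : ι => gaussianReal 0 1) (X := fun _ => id) (fun _ => aemeasurable_id)

lemma stdG_memLp_mul (a b : ι) :
    MemLp (fun w : ι → ℝ => w a * w b) 2 (_root_.stdGaussian ι) := by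
  have h : ∀ a : ι, MemLp (fun w : ι → ℝ => w a) 4 (_root_.stdGaussian ι) := fun a =>
    (memLp_id_gaussianReal (μ := 0) (v := 1) 4).comp_measurePreserving (stdG_eval a)
  haveI : ENNReal.HolderTriple 4 4 2 := ⟨by
    rw [← ENNReal.toReal_eq_toReal_iff' (by simp) (by simp), ENNReal.toReal_add (by simp) (by simp)]
    norm_num⟩
  exact (h b).mul (h a)

lemma stdG_integral_mul [DecidableEq ι] (a b : ι) :
    ∫ w, w a * w b ∂(_root_.stdGaussian ι) = if a = b then 1 else 0 := by
  have h0 : ∀ a : ι, ∫ w, w a ∂(_root_.stdGaussian ι) = 0 := fun a => by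
    have h := integral_map (μ := _root_.stdGaussian ι) (measurable_pi_apply a).aemeasurable
      (f := fun x : ℝ => x) (by fun_prop)
    rw [← h]
    have h2 : Measure.map (fun w : ι → ℝ => w a) (_root_.stdGaussian ι) = gaussianReal 0 1 :=
      (stdG_eval a).map_eq
    rw [h2, integral_id_gaussianReal]
  split_ifs with hab
  · subst hab
    have h := integral_map (μ := _root_.stdGaussian ι) (measurable_pi_apply a).aemeasurable
      (f := fun x : ℝ => x * x) (by fun_prop)
    rw [← h]
    have h2 : Measure.map (fun w : ι → ℝ => w a) (_root_.stdGaussian ι) = gaussianReal 0 1 :=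
      (stdG_eval a).map_eq
    rw [h2]
    have h3 := variance_fun_id_gaussianReal (μ := 0) (v := 1)
    rw [variance_eq_integral (by fun_prop), integral_id_gaussianReal] at h3
    simpa [pow_two] using h3
  · rw [(stdG_indep.indepFun hab).integral_fun_mul_eq_mul_integral
      (measurable_pi_apply a).aestronglyMeasurable (measurable_pi_apply b).aestronglyMeasurable]
    simp [h0]

lemma stdG_reindex {κ : Type*} [Fintype κ] (e : κ → ι) (he : e.Injective) :
    MeasurePreserving (fun (w : ι → ℝ) (k : κ) => w (e k)) (_root_.stdGaussian ι)
      (_root_.stdGaussian κ) := by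
  refine ⟨by fun_prop, ?_⟩
  have h := (stdG_indep (ι := ι)).precomp he
  rw [iIndepFun_iff_map_fun_eq_pi_map (fun i => (measurable_pi_apply (e i)).aemeasurable)] at h
  rw [h]
  simp only [(stdG_eval _).map_eq]
  rfl

lemma stdG_indep_reindex {κ : Type*} [Fintype κ] (e e' : κ → ι) (he : ∀ k l, e k ≠ e' l) :
    IndepFun (fun (w : ι → ℝ) (k : κ) => w (e k)) (fun (w : ι → ℝ) (k : κ) => w (e' k))
      (_root_.stdGaussian ι) := by
  classical
  have h := (stdG_indep (ι := ι)).indepFun_finset (Finset.univ.image e) (Finset.univ.image e')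
    (by
      rw [Finset.disjoint_left]
      intro a ha ha'
      simp only [Finset.mem_image, Finset.mem_univ, true_and] at ha ha'
      obtain ⟨k, rfl⟩ := ha
      obtain ⟨l, hl⟩ := ha'
      exact he k l hl.symm) (fun a => measurable_pi_apply a)
  exact h.comp (φ := fun (v : Finset.univ.image e → ℝ) (k : κ) => v ⟨e k, by simp⟩)
    (ψ := fun (v : Finset.univ.image e' → ℝ) (k : κ) => v ⟨e' k, by simp⟩)
    (measurable_pi_lambda _ fun k => measurable_pi_apply _)
    (measurable_pi_lambda _ fun k => measurable_pi_apply _)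

end aux

/-- The contribution of one hidden neuron. -/
noncomputable def neuron {D : ℕ} (x x' : Fin D → ℝ) (w : Option (Fin D) → ℝ) : ℝ :=
  (∑ α, w (some α) * x α) * (∑ α, w (some α) * x' α) + w none ^ 2 * ∑ α, x α * x' α

lemma neuron_eq {D : ℕ} (x x' : Fin D → ℝ) : neuron x x' = fun w =>
    (∑ α, ∑ β, (x α * x' β) * (w (some α) * w (some β)))
      + (∑ α, x α * x' α) * (w none * w none) := by
  funext w
  unfold neuron
  rw [Finset.sum_mul_sum]
  congr 1
  · refine Finset.sum_congr rfl fun _ _ => Finset.sum_congr rfl fun _ _ => by ring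
  · ring

lemma neuron_measurable {D : ℕ} (x x' : Fin D → ℝ) : Measurable (neuron x x') := by
  unfold neuron; fun_prop

lemma neuron_memLp {D : ℕ} (x x' : Fin D → ℝ) :
    MemLp (neuron x x') 2 (_root_.stdGaussian (Option (Fin D))) := by
  rw [neuron_eq]
  exact (memLp_finsetSum _ fun α _ => memLp_finsetSum _ fun β _ =>
    (stdG_memLp_mul _ _).const_mul _).add ((stdG_memLp_mul _ _).const_mul _)

lemma neuron_integral {D : ℕ} (x x' : Fin D → ℝ) :
    ∫ w, neuron x x' w ∂(_root_.stdGaussian (Option (Fin D))) = 2 * ∑ α, x α * x' α := by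
  have hi : ∀ (a b : Option (Fin D)) (c : ℝ),
      Integrable (fun w : Option (Fin D) → ℝ => c * (w a * w b))
        (_root_.stdGaussian (Option (Fin D))) := fun a b c =>
    ((stdG_memLp_mul a b).integrable (by norm_num)).const_mul c
  rw [neuron_eq, integral_add
    (integrable_finsetSum _ fun α _ => integrable_finsetSum _ fun β _ => hi _ _ _) (hi _ _ _),
    integral_finsetSum _ (fun α _ => integrable_finsetSum _ fun β _ => hi _ _ _)]
  simp_rw [integral_finsetSum _ (fun β _ => hi _ _ _), integral_const_mul, stdG_integral_mul]
  simp
  ring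

/-- Parameter indices of the `i`-th hidden neuron. -/
def nidx (n D : ℕ) (i : Fin n) : Option (Fin D) → Fin n ⊕ Fin n × Fin D
  | none => Sum.inl i
  | some α => Sum.inr (i, α)

/-- The NTK of the one-hidden-layer linear network at a random standard Gaussian
initialization converges in probability to `2⟨x,x'⟩` as the width `n → ∞`. -/
theorem ntk_converges_in_probability (D : ℕ) (x x' : Fin D → ℝ) :
    ∀ ε : ℝ, 0 < ε →
      Tendsto
        (fun n : ℕ =>
          stdGaussian (Fin n ⊕ Fin n × Fin D)
            {θ | ε < |ntk1 n D θ x x' - 2 * ∑ α : Fin D, x α * x' α|})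
        atTop (nhds 0) := by
  intro ε hε
  set v := Var[neuron x x'; _root_.stdGaussian (Option (Fin D))] with hv
  have key : ∀ n : ℕ, 0 < n → _root_.stdGaussian (Fin n ⊕ Fin n × Fin D)
      {θ | ε < |ntk1 n D θ x x' - 2 * ∑ α : Fin D, x α * x' α|}
        ≤ ENNReal.ofReal (v / ε ^ 2 * (n : ℝ)⁻¹) := by
    intro n hn
    have hn' : (n : ℝ) ≠ 0 := by positivity
    let Y : Fin n → ((Fin n ⊕ Fin n × Fin D) → ℝ) → ℝ := fun i θ =>
      neuron x x' (fun k => θ (nidx n D i k))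
    have hinj : ∀ i, (nidx n D i).Injective := by
      rintro i (_ | a) (_ | b) h <;> simp_all [nidx]
    have hmp := fun i => stdG_reindex (nidx n D i) (hinj i)
    have hL : ∀ i, MemLp (Y i) 2 (_root_.stdGaussian _) := fun i =>
      (neuron_memLp x x').comp_measurePreserving (hmp i)
    have hE : ∀ i, ∫ θ, Y i θ ∂(_root_.stdGaussian _) = 2 * ∑ α, x α * x' α := fun i => by
      rw [← neuron_integral, ← (hmp i).map_eq, integral_map (hmp i).measurable.aemeasurable
        (neuron_measurable x x').aestronglyMeasurable]
    have hV : ∀ i, Var[Y i; _root_.stdGaussian _] = v := fun i => by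
      rw [hv, ← (hmp i).map_eq, variance_map (neuron_measurable x x').aemeasurable
        (hmp i).measurable.aemeasurable]
      rfl
    have hI : ∀ i j, i ≠ j → IndepFun (Y i) (Y j) (_root_.stdGaussian _) := by
      intro i j hij
      refine (stdG_indep_reindex (nidx n D i) (nidx n D j) ?_).comp
        (neuron_measurable x x') (neuron_measurable x x')
      rintro (_ | a) (_ | b) h <;> simp_all [nidx]
    have hX : ∀ θ, ntk1 n D θ x x' = (n : ℝ)⁻¹ * (∑ i, Y i) θ := by
      intro θ
      rw [ntk1_eq, Finset.sum_apply]
      rfl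
    have hS : MemLp (∑ i, Y i) 2 (_root_.stdGaussian _) := memLp_finsetSum' _ fun i _ => hL i
    have hT := hS.const_mul (n : ℝ)⁻¹
    have hmean : ∫ θ, (n : ℝ)⁻¹ * (∑ i, Y i) θ ∂(_root_.stdGaussian _)
        = 2 * ∑ α, x α * x' α := by
      rw [integral_const_mul]
      simp only [Finset.sum_apply]
      rw [integral_finsetSum _ fun i _ => (hL i).integrable (by norm_num)]
      simp only [hE]
      simp
      field_simp
    have hvar : Var[fun θ => (n : ℝ)⁻¹ * (∑ i, Y i) θ; _root_.stdGaussian _]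
        = v * (n : ℝ)⁻¹ := by
      rw [variance_const_mul, IndepFun.variance_sum (fun i _ => hL i)
        (fun i _ j _ hij => hI i j hij)]
      simp only [hV]
      simp
      field_simp
    have := meas_ge_le_variance_div_sq hT hε
    rw [hmean, hvar] at this
    refine (measure_mono ?_).trans (this.trans (le_of_eq ?_))
    · intro θ hθ
      simp only [Set.mem_ofPred_eq, hX] at hθ ⊢
      exact hθ.le
    · congr 1; ring
  have hlim : Tendsto (fun n : ℕ => ENNReal.ofReal (v / ε ^ 2 * (n : ℝ)⁻¹)) atTop (nhds 0) := by
    have h := (tendsto_inv_atTop_nhds_zero_nat (𝕜 := ℝ)).const_mul (v / ε ^ 2)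
    rw [mul_zero] at h
    simpa using ENNReal.tendsto_ofReal h
  exact tendsto_of_tendsto_of_tendsto_of_le_of_le' tendsto_const_nhds hlim
    (Eventually.of_forall fun _ => bot_le)
    ((eventually_gt_atTop 0).mono fun n hn => key n hn)
end

section
/- Fix a learning rate η > 0, a finite training set D = {(x_a, y_a)} with x_a ∈ ℝ^{D_in}, y_a ∈ ℝ, and a test input x ∈ ℝ^{D_in}. For each width n, consider the one-hidden-layer linear network f_θ(x) = n^{-1/2} Σ_{i=1}^n V_i (Σ_α U_{iα} x_α) with independent standard Gaussian initialization, the MSE loss L(θ) = (1/2) Σ_a (f_θ(x_a) − y_a)², the single gradient descent update θ' = θ − η ∇L(θ), and the Neural Tangent Kernel Θ_θ(x,x') = Σ_μ (∂f_θ(x)/∂θ^μ)(∂f_θ(x')/∂θ^μ). Then the expected deviation of the one-step update from the kernel-linearized update satisfies E_θ[ f_{θ'}(x) − f_θ(x) + η Σ_a Θ_θ(x, x_a)(f_θ(x_a) − y_a) ] = O(n^{−1}) as n → ∞; i.e., in expectation the discrete gradient descent update of the network function is linear in η and governed by the NTK, up to O(n^{−1}) corrections. -/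
open MeasureTheory ProbabilityTheory Asymptotics Filter

/-- The MSE loss `L(θ) = (1/2) Σ_{(x_a,y_a) ∈ D} (f_θ(x_a) − y_a)²` over a finite training
set. -/
noncomputable def mseLoss (n D : ℕ) (Dtr : Finset ((Fin D → ℝ) × ℝ))
    (θ : (Fin n ⊕ Fin n × Fin D) → ℝ) : ℝ :=
  (1 / 2 : ℝ) * ∑ p ∈ Dtr, (net1 n D θ p.1 - p.2) ^ 2

/-- A single gradient descent step `θ' = θ − η ∇L(θ)`, written componentwise as
`θ'^μ = θ^μ − η ∂L/∂θ^μ`. -/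
noncomputable def gdStep (n D : ℕ) (η : ℝ) (Dtr : Finset ((Fin D → ℝ) × ℝ))
    (θ : (Fin n ⊕ Fin n × Fin D) → ℝ) : (Fin n ⊕ Fin n × Fin D) → ℝ :=
  fun μ => θ μ - η * fderiv ℝ (mseLoss n D Dtr) θ (Pi.single μ 1)



lemma gdaux_flip {ι : Type*} [Fintype ι] (s : ι → ℝ) (hs : ∀ k, s k ^ 2 = 1) :
    MeasurePreserving (fun (θ : ι → ℝ) k => s k * θ k) (stdGaussian ι) (stdGaussian ι) := by
  unfold _root_.stdGaussian
  refine measurePreserving_pi (fun _ => gaussianReal 0 1) (fun _ => gaussianReal 0 1)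
    (f := fun k t => s k * t) ?_
  intro k
  refine ⟨by fun_prop, ?_⟩
  rw [gaussianReal_map_const_mul]
  congr 1
  · simp
  · ext; simp [hs k]

lemma gdaux_integral_flip {ι : Type*} [Fintype ι] (s : ι → ℝ) (hs : ∀ k, s k ^ 2 = 1)
    (g : (ι → ℝ) → ℝ) (hg : Integrable g (stdGaussian ι)) :
    ∫ θ, g (fun k => s k * θ k) ∂(stdGaussian ι) = ∫ θ, g θ ∂(stdGaussian ι) := by
  have h := gdaux_flip s hs
  conv_rhs => rw [← h.map_eq]
  rw [integral_map h.measurable.aemeasurable]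
  rw [h.map_eq]; exact hg.1

lemma gdaux_sq_integrable : Integrable (fun t : ℝ => t ^ 2) (gaussianReal 0 1) := by
  have h : MemLp id 2 (gaussianReal 0 1) := memLp_id_gaussianReal 2
  exact h.integrable_sq

lemma gdaux_sq_integral : ∫ t : ℝ, t ^ 2 ∂(gaussianReal 0 1) = 1 := by
  have h := variance_eq_integral (μ := gaussianReal 0 1) (X := id) (by fun_prop)
  rw [variance_id_gaussianReal] at h
  simpa using h.symm

lemma gdaux_prod_eq {ι : Type*} [Fintype ι] [DecidableEq ι] (i j : ι) (hij : i ≠ j) (θ : ι → ℝ) :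
    (θ i * θ j) ^ 2 = ∏ k, (fun (k : ι) (t : ℝ) => if k = i ∨ k = j then t ^ 2 else 1) k (θ k) := by
  have : ∀ k, (if k = i ∨ k = j then θ k ^ 2 else 1) =
      (if k = i then θ k ^ 2 else 1) * (if k = j then θ k ^ 2 else 1) := by
    intro k
    by_cases h1 : k = i
    · subst h1; simp [hij]
    · simp [h1]
  simp only [this, Finset.prod_mul_distrib]
  simp [mul_pow]

lemma gdaux_pair {ι : Type*} [Fintype ι] [DecidableEq ι] (i j : ι) (hij : i ≠ j) :
    Integrable (fun θ : ι → ℝ => (θ i * θ j) ^ 2) (stdGaussian ι) ∧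
      ∫ θ : ι → ℝ, (θ i * θ j) ^ 2 ∂(stdGaussian ι) = 1 := by
  simp only [gdaux_prod_eq i j hij]
  unfold _root_.stdGaussian
  constructor
  · apply Integrable.fintype_prod (f := fun (k : ι) (t : ℝ) => if k = i ∨ k = j then t ^ 2 else 1)
    intro k
    by_cases h : k = i ∨ k = j
    · simpa [h] using gdaux_sq_integrable
    · simp [h]
  · rw [integral_fintype_prod_eq_prod
      (f := fun (k : ι) (t : ℝ) => if k = i ∨ k = j then t ^ 2 else 1)]
    apply Finset.prod_eq_one
    intro k _
    by_cases h : k = i ∨ k = j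
    · simpa [h] using gdaux_sq_integral
    · simp [h]

lemma gdaux_h_integrable (n D : ℕ) (k l : Fin n × Fin D) :
    Integrable (fun θ : (Fin n ⊕ Fin n × Fin D) → ℝ =>
      (θ (Sum.inl k.1) * θ (Sum.inr k)) * (θ (Sum.inl l.1) * θ (Sum.inr l)))
      (stdGaussian (Fin n ⊕ Fin n × Fin D)) := by
  have h1 := (gdaux_pair (Sum.inl k.1 : Fin n ⊕ Fin n × Fin D) (Sum.inr k) (by simp)).1
  have h2 := (gdaux_pair (Sum.inl l.1 : Fin n ⊕ Fin n × Fin D) (Sum.inr l) (by simp)).1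
  refine (h1.add h2).mono' (by fun_prop) (Eventually.of_forall fun θ => ?_)
  simp only [Pi.add_apply, Real.norm_eq_abs, abs_le]
  constructor <;> nlinarith [sq_nonneg (θ (Sum.inl k.1) * θ (Sum.inr k) + (θ (Sum.inl l.1) * θ (Sum.inr l))), sq_nonneg (θ (Sum.inl k.1) * θ (Sum.inr k) - (θ (Sum.inl l.1) * θ (Sum.inr l))), sq_nonneg (θ (Sum.inl k.1) * θ (Sum.inr k)), sq_nonneg (θ (Sum.inl l.1) * θ (Sum.inr l))]

lemma gdaux_h_integral (n D : ℕ) (k l : Fin n × Fin D) :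
    ∫ θ : (Fin n ⊕ Fin n × Fin D) → ℝ,
      (θ (Sum.inl k.1) * θ (Sum.inr k)) * (θ (Sum.inl l.1) * θ (Sum.inr l))
      ∂(stdGaussian (Fin n ⊕ Fin n × Fin D)) = if k = l then 1 else 0 := by
  split_ifs with h
  · subst h
    have h1 := (gdaux_pair (Sum.inl k.1 : Fin n ⊕ Fin n × Fin D) (Sum.inr k) (by simp)).2
    simpa only [sq] using h1
  · have h1 := gdaux_integral_flip
      (fun μ : Fin n ⊕ Fin n × Fin D => if μ = Sum.inr k then (-1 : ℝ) else 1)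
      (by intro μ; split_ifs <;> norm_num) _ (gdaux_h_integrable n D k l)
    have h' : ¬ l = k := fun e => h e.symm
    simp only [Sum.inr.injEq, reduceCtorEq, if_true, if_false, h', one_mul, neg_mul, mul_neg,
      integral_neg] at h1
    linarith

lemma gdaux_c_sq (n : ℕ) : ((n : ℝ) ^ (-(1 / 2 : ℝ))) ^ 2 = (n : ℝ)⁻¹ := by
  rw [← Real.rpow_natCast, ← Real.rpow_mul (Nat.cast_nonneg n), ← Real.rpow_neg_one]
  norm_num

lemma gdaux_net_sq (n D : ℕ) (x : Fin D → ℝ) (θ : (Fin n ⊕ Fin n × Fin D) → ℝ) :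
    net1 n D θ x ^ 2 = ∑ k : Fin n × Fin D, ∑ l : Fin n × Fin D, ((n : ℝ)⁻¹ * x k.2 * x l.2) *
      ((θ (Sum.inl k.1) * θ (Sum.inr k)) * (θ (Sum.inl l.1) * θ (Sum.inr l))) := by
  have h : net1 n D θ x = (n : ℝ) ^ (-(1 / 2 : ℝ)) *
      ∑ k : Fin n × Fin D, x k.2 * (θ (Sum.inl k.1) * θ (Sum.inr k)) := by
    unfold net1
    rw [Fintype.sum_prod_type]
    simp only [Finset.mul_sum]
    refine Finset.sum_congr rfl fun i _ => Finset.sum_congr rfl fun j _ => by ring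
  rw [h, mul_pow, gdaux_c_sq, sq, Finset.sum_mul_sum, Finset.mul_sum]
  refine Finset.sum_congr rfl fun i _ => ?_
  rw [Finset.mul_sum]
  refine Finset.sum_congr rfl fun j _ => by ring

lemma gdaux_net_integrable (n D : ℕ) (x : Fin D → ℝ) :
    Integrable (fun θ => net1 n D θ x ^ 2) (stdGaussian (Fin n ⊕ Fin n × Fin D)) := by
  simp only [gdaux_net_sq]
  exact integrable_finsetSum _ fun k _ => integrable_finsetSum _ fun l _ =>
    (gdaux_h_integrable n D k l).const_mul _

lemma gdaux_net_integral (n D : ℕ) (x : Fin D → ℝ) :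
    ∫ θ, net1 n D θ x ^ 2 ∂(stdGaussian (Fin n ⊕ Fin n × Fin D)) ≤ ∑ α, x α ^ 2 := by
  simp only [gdaux_net_sq]
  rw [integral_finsetSum _ fun k _ => integrable_finsetSum _ fun l _ =>
    (gdaux_h_integrable n D k l).const_mul _]
  have : ∀ k : Fin n × Fin D, ∫ θ : (Fin n ⊕ Fin n × Fin D) → ℝ,
      ∑ l : Fin n × Fin D, ((n : ℝ)⁻¹ * x k.2 * x l.2) *
      ((θ (Sum.inl k.1) * θ (Sum.inr k)) * (θ (Sum.inl l.1) * θ (Sum.inr l)))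
      ∂(stdGaussian (Fin n ⊕ Fin n × Fin D)) = (n : ℝ)⁻¹ * x k.2 ^ 2 := by
    intro k
    rw [integral_finsetSum _ fun l _ => (gdaux_h_integrable n D k l).const_mul _]
    simp only [integral_const_mul, gdaux_h_integral]
    simp
    ring
  simp only [this]
  rw [Fintype.sum_prod_type]
  simp only [← Finset.mul_sum, Finset.sum_const, Finset.card_univ, Fintype.card_fin, nsmul_eq_mul]
  have h0 : 0 ≤ ∑ α, x α ^ 2 := Finset.sum_nonneg fun _ _ => sq_nonneg _
  rw [← mul_assoc]
  refine mul_le_of_le_one_left h0 ?_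
  rcases Nat.eq_zero_or_pos n with rfl | h
  · simp
  · exact (inv_mul_cancel₀ (by positivity)).le

lemma gdaux_hasFDerivAt (n D : ℕ) (x : Fin D → ℝ) (θ : (Fin n ⊕ Fin n × Fin D) → ℝ) :
    DifferentiableAt ℝ (fun ψ => net1 n D ψ x) θ := by
  unfold net1
  fun_prop

lemma gdaux_add (n D : ℕ) (x : Fin D → ℝ) (θ v : (Fin n ⊕ Fin n × Fin D) → ℝ) :
    net1 n D (θ + v) x = net1 n D θ x + (n : ℝ) ^ (-(1 / 2 : ℝ)) * (∑ i : Fin n,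
        (v (Sum.inl i) * ∑ α, θ (Sum.inr (i, α)) * x α +
          θ (Sum.inl i) * ∑ α, v (Sum.inr (i, α)) * x α)) + net1 n D v x := by
  unfold net1
  rw [← mul_add, ← mul_add, ← Finset.sum_add_distrib, ← Finset.sum_add_distrib]
  congr 1
  refine Finset.sum_congr rfl fun i _ => ?_
  simp only [Pi.add_apply, add_mul, Finset.sum_add_distrib]
  ring

lemma gdaux_smul (n D : ℕ) (x : Fin D → ℝ) (t : ℝ) (v : (Fin n ⊕ Fin n × Fin D) → ℝ) :
    net1 n D (t • v) x = t ^ 2 * net1 n D v x := by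
  unfold net1
  rw [mul_left_comm (t ^ 2), Finset.mul_sum _ _ (t ^ 2)]
  congr 1
  refine Finset.sum_congr rfl fun i _ => ?_
  simp only [Pi.smul_apply, smul_eq_mul, mul_assoc, ← Finset.mul_sum]
  ring

lemma gdaux_fderiv (n D : ℕ) (x : Fin D → ℝ) (θ v : (Fin n ⊕ Fin n × Fin D) → ℝ) :
    fderiv ℝ (fun ψ => net1 n D ψ x) θ v = (n : ℝ) ^ (-(1 / 2 : ℝ)) * (∑ i : Fin n,
        (v (Sum.inl i) * ∑ α, θ (Sum.inr (i, α)) * x α +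
          θ (Sum.inl i) * ∑ α, v (Sum.inr (i, α)) * x α)) := by
  rw [← (gdaux_hasFDerivAt n D x θ).lineDeriv_eq_fderiv, lineDeriv]
  set L := (n : ℝ) ^ (-(1 / 2 : ℝ)) * (∑ i : Fin n,
        (v (Sum.inl i) * ∑ α, θ (Sum.inr (i, α)) * x α +
          θ (Sum.inl i) * ∑ α, v (Sum.inr (i, α)) * x α)) with hL
  have : (fun t : ℝ => net1 n D (θ + t • v) x) =
      fun t => net1 n D θ x + t * L + t ^ 2 * net1 n D v x := by
    funext t
    rw [gdaux_add, gdaux_smul]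
    congr 2
    rw [hL, mul_left_comm t, Finset.mul_sum _ _ t]
    congr 1
    refine Finset.sum_congr rfl fun i _ => ?_
    simp only [Pi.smul_apply, smul_eq_mul, mul_assoc, ← Finset.mul_sum]
    ring
  rw [this]
  have h : HasDerivAt (fun t : ℝ => net1 n D θ x + t * L + t ^ 2 * net1 n D v x)
      (1 * L + (2 * (0:ℝ) ^ (2-1) * 1) * net1 n D v x) 0 :=
    (((hasDerivAt_id (0:ℝ)).mul_const L).const_add _).add
      (((hasDerivAt_id (0:ℝ)).pow 2).mul_const _)
  rw [h.deriv]
  simp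

lemma gdaux_loss (n D : ℕ) (Dtr : Finset ((Fin D → ℝ) × ℝ))
    (θ v : (Fin n ⊕ Fin n × Fin D) → ℝ) :
    fderiv ℝ (mseLoss n D Dtr) θ v =
      ∑ p ∈ Dtr, (net1 n D θ p.1 - p.2) * fderiv ℝ (fun ψ => net1 n D ψ p.1) θ v := by
  have h : HasFDerivAt (mseLoss n D Dtr) ((1 / 2 : ℝ) • ∑ p ∈ Dtr,
      (2 • (net1 n D θ p.1 - p.2) ^ (2 - 1)) • fderiv ℝ (fun ψ => net1 n D ψ p.1) θ) θ := by
    unfold mseLoss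
    refine HasFDerivAt.const_mul ?_ _
    refine HasFDerivAt.fun_sum fun p _ => ?_
    exact ((gdaux_hasFDerivAt n D p.1 θ).hasFDerivAt.sub_const p.2).pow 2
  rw [h.fderiv]
  simp only [ContinuousLinearMap.smul_apply, ContinuousLinearMap.sum_apply, smul_eq_mul,
    Finset.mul_sum]
  refine Finset.sum_congr rfl fun p _ => ?_
  simp
  ring

lemma gdaux_dev (n D : ℕ) (η : ℝ) (Dtr : Finset ((Fin D → ℝ) × ℝ)) (x : Fin D → ℝ)
    (θ : (Fin n ⊕ Fin n × Fin D) → ℝ) :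
    net1 n D (gdStep n D η Dtr θ) x - net1 n D θ x +
      η * ∑ p ∈ Dtr, ntk1 n D θ x p.1 * (net1 n D θ p.1 - p.2) =
    η ^ 2 * (n : ℝ)⁻¹ * ((∑ p ∈ Dtr, (net1 n D θ p.1 - p.2) * net1 n D θ p.1) *
      (∑ p ∈ Dtr, (net1 n D θ p.1 - p.2) * ∑ α, p.1 α * x α)) := by
  set G : (Fin n ⊕ Fin n × Fin D) → ℝ :=
    fun μ => fderiv ℝ (mseLoss n D Dtr) θ (Pi.single μ 1) with hG
  have e1 : gdStep n D η Dtr θ = θ + (-η) • G := by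
    funext μ; simp [gdStep, hG]; ring
  have e2 : fderiv ℝ (fun ψ => net1 n D ψ x) θ G =
      ∑ p ∈ Dtr, ntk1 n D θ x p.1 * (net1 n D θ p.1 - p.2) := by
    have : G = ∑ μ, G μ • (Pi.single μ (1:ℝ) : (Fin n ⊕ Fin n × Fin D) → ℝ) := by
      exact pi_eq_sum_univ' G |>.trans (by
        refine Finset.sum_congr rfl fun μ _ => ?_
        congr 1)
    rw [this, map_sum]
    simp only [map_smul, smul_eq_mul, hG, gdaux_loss, ntk1, Finset.sum_mul]
    rw [Finset.sum_comm]
    refine Finset.sum_congr rfl fun p _ => Finset.sum_congr rfl fun μ _ => by ring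
  have e3 : net1 n D (θ + (-η) • G) x = net1 n D θ x
      + fderiv ℝ (fun ψ => net1 n D ψ x) θ ((-η) • G) + net1 n D ((-η) • G) x := by
    rw [gdaux_add, gdaux_fderiv]
  rw [e1, e3, map_smul, e2, gdaux_smul, smul_eq_mul]
  set c := (n : ℝ) ^ (-(1 / 2 : ℝ)) with hc
  have gl : ∀ i, G (Sum.inl i) = ∑ p ∈ Dtr, (net1 n D θ p.1 - p.2) *
      (c * ∑ α, θ (Sum.inr (i, α)) * p.1 α) := by
    intro i
    simp only [hG, gdaux_loss, gdaux_fderiv]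
    refine Finset.sum_congr rfl fun p _ => ?_
    simp [Pi.single_apply, hc]
  have gr : ∀ i α, G (Sum.inr (i, α)) = ∑ p ∈ Dtr, (net1 n D θ p.1 - p.2) *
      (c * (θ (Sum.inl i) * p.1 α)) := by
    intro i α
    simp only [hG, gdaux_loss, gdaux_fderiv]
    refine Finset.sum_congr rfl fun p _ => ?_
    simp [Pi.single_apply, hc, ite_and]
  have gx : ∀ i, ∑ α, G (Sum.inr (i, α)) * x α = c * θ (Sum.inl i) *
      ∑ p ∈ Dtr, (net1 n D θ p.1 - p.2) * ∑ α, p.1 α * x α := by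
    intro i
    simp only [gr, Finset.sum_mul, Finset.mul_sum]
    rw [Finset.sum_comm]
    refine Finset.sum_congr rfl fun p _ => Finset.sum_congr rfl fun μ _ => by ring
  have key : net1 n D G x = c ^ 2 * ((∑ p ∈ Dtr, (net1 n D θ p.1 - p.2) * net1 n D θ p.1) *
      (∑ p ∈ Dtr, (net1 n D θ p.1 - p.2) * ∑ α, p.1 α * x α)) := by
    set B := ∑ p ∈ Dtr, (net1 n D θ p.1 - p.2) * ∑ α, p.1 α * x α
    have hA : ∑ p ∈ Dtr, (net1 n D θ p.1 - p.2) * net1 n D θ p.1 =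
        ∑ i, θ (Sum.inl i) * G (Sum.inl i) := by
      simp only [gl, Finset.mul_sum (s := Dtr)]
      rw [Finset.sum_comm]
      refine Finset.sum_congr rfl fun p _ => ?_
      generalize net1 n D θ p.1 - p.2 = r
      rw [show net1 n D θ p.1 = c * ∑ i : Fin n, θ (Sum.inl i) *
        ∑ α : Fin D, θ (Sum.inr (i, α)) * p.1 α from rfl]
      rw [Finset.mul_sum, Finset.mul_sum]
      refine Finset.sum_congr rfl fun i _ => ?_
      ring
    rw [hA, show net1 n D G x = c * ∑ i : Fin n, G (Sum.inl i) *
        ∑ α : Fin D, G (Sum.inr (i, α)) * x α from rfl]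
    simp only [gx, Finset.mul_sum, Finset.sum_mul]
    refine Finset.sum_congr rfl fun i _ => by ring
  rw [key, hc, gdaux_c_sq]
  ring

lemma gdaux_bound (D : ℕ) (Dtr : Finset ((Fin D → ℝ) × ℝ))
    (f w : (Fin D → ℝ) × ℝ → ℝ) :
    |(∑ p ∈ Dtr, (f p - p.2) * f p) * (∑ p ∈ Dtr, (f p - p.2) * w p) +
      (∑ p ∈ Dtr, (-f p - p.2) * -f p) * (∑ p ∈ Dtr, (-f p - p.2) * w p)| ≤
    (2 * |∑ p ∈ Dtr, p.2 * w p| + (∑ p ∈ Dtr, p.2 ^ 2) + ∑ p ∈ Dtr, w p ^ 2) *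
      ∑ p ∈ Dtr, f p ^ 2 := by
  have e1 : ∑ p ∈ Dtr, (f p - p.2) * f p = ∑ p ∈ Dtr, f p ^ 2 - ∑ p ∈ Dtr, p.2 * f p := by
    rw [← Finset.sum_sub_distrib]; exact Finset.sum_congr rfl fun p _ => by ring
  have e2 : ∑ p ∈ Dtr, (-f p - p.2) * -f p = ∑ p ∈ Dtr, f p ^ 2 + ∑ p ∈ Dtr, p.2 * f p := by
    rw [← Finset.sum_add_distrib]; exact Finset.sum_congr rfl fun p _ => by ring
  have e3 : ∑ p ∈ Dtr, (f p - p.2) * w p = ∑ p ∈ Dtr, w p * f p - ∑ p ∈ Dtr, p.2 * w p := by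
    rw [← Finset.sum_sub_distrib]; exact Finset.sum_congr rfl fun p _ => by ring
  have e4 : ∑ p ∈ Dtr, (-f p - p.2) * w p = - ∑ p ∈ Dtr, w p * f p - ∑ p ∈ Dtr, p.2 * w p := by
    rw [← Finset.sum_neg_distrib, ← Finset.sum_sub_distrib]
    exact Finset.sum_congr rfl fun p _ => by ring
  rw [e1, e2, e3, e4]
  have c1 := Finset.sum_mul_sq_le_sq_mul_sq Dtr (fun p => p.2) f
  have c2 := Finset.sum_mul_sq_le_sq_mul_sq Dtr w f
  have c3 : 0 ≤ ∑ p ∈ Dtr, f p ^ 2 := Finset.sum_nonneg fun _ _ => sq_nonneg _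
  generalize ∑ p ∈ Dtr, f p ^ 2 = S at *
  generalize ∑ p ∈ Dtr, p.2 * f p = A at *
  generalize ∑ p ∈ Dtr, w p * f p = B at *
  generalize ∑ p ∈ Dtr, p.2 * w p = B0 at *
  have d1 := mul_le_mul_of_nonneg_right (le_abs_self B0) c3
  have d2 := mul_le_mul_of_nonneg_right (neg_abs_le B0) c3
  rw [abs_le]
  constructor <;> nlinarith [sq_nonneg (A + B), sq_nonneg (A - B)]


/-- For the one-hidden-layer linear network with standard Gaussian initialization, the
expected deviation of the single gradient descent update of the network function from the
kernel-linearized (NTK) update is `O(n⁻¹)` as the width `n → ∞`: in expectation,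
`f_{θ'}(x) − f_θ(x) = −η Σ_a Θ_θ(x,x_a)(f_θ(x_a) − y_a) + O(n⁻¹)`. -/
theorem gd_update_linear_in_lr_isBigO (D : ℕ) (η : ℝ) (hη : 0 < η)
    (Dtr : Finset ((Fin D → ℝ) × ℝ)) (x : Fin D → ℝ) :
    (fun n : ℕ =>
        ∫ θ,
          (net1 n D (gdStep n D η Dtr θ) x - net1 n D θ x +
            η * ∑ p ∈ Dtr, ntk1 n D θ x p.1 * (net1 n D θ p.1 - p.2))
          ∂(stdGaussian (Fin n ⊕ Fin n × Fin D)))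
      =O[atTop] (fun n : ℕ => (n : ℝ)⁻¹) := by
  set w : (Fin D → ℝ) × ℝ → ℝ := fun p => ∑ α, p.1 α * x α with hw
  set K := 2 * |∑ p ∈ Dtr, p.2 * w p| + (∑ p ∈ Dtr, p.2 ^ 2) + ∑ p ∈ Dtr, w p ^ 2 with hK
  have hK0 : 0 ≤ K := by positivity
  refine IsBigO.of_bound (η ^ 2 * (K * ∑ p ∈ Dtr, ∑ α, p.1 α ^ 2)) (Eventually.of_forall fun n => ?_)
  simp only [gdaux_dev, integral_const_mul]
  rw [norm_mul, norm_mul, Real.norm_of_nonneg (sq_nonneg η), mul_assoc, mul_assoc,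
    mul_comm _ ‖(n : ℝ)⁻¹‖]
  refine mul_le_mul_of_nonneg_left (mul_le_mul_of_nonneg_left ?_ (norm_nonneg _)) (sq_nonneg η)
  set P := stdGaussian (Fin n ⊕ Fin n × Fin D) with hP
  set g : ((Fin n ⊕ Fin n × Fin D) → ℝ) → ℝ := fun θ =>
    (∑ p ∈ Dtr, (net1 n D θ p.1 - p.2) * net1 n D θ p.1) *
      (∑ p ∈ Dtr, (net1 n D θ p.1 - p.2) * w p) with hg
  have hR0 : 0 ≤ K * ∑ p ∈ Dtr, ∑ α, p.1 α ^ 2 := by positivity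
  change ‖∫ θ, g θ ∂P‖ ≤ _
  by_cases hint : Integrable g P
  swap
  · rw [integral_undef hint]; simpa using hR0
  set s : Fin n ⊕ Fin n × Fin D → ℝ := Sum.elim (fun _ => -1) (fun _ => 1) with hs
  have hs2 : ∀ k, s k ^ 2 = 1 := by rintro (k | k) <;> simp [hs]
  have hflip := gdaux_integral_flip s hs2 g hint
  have hint' : Integrable (fun θ => g (fun k => s k * θ k)) P :=
    (gdaux_flip s hs2).integrable_comp_of_integrable hint
  have hnet : ∀ θ y, net1 n D (fun k => s k * θ k) y = - net1 n D θ y := by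
    intro θ y
    simp [net1, hs]
  have hsum : ∫ θ, (g θ + g (fun k => s k * θ k)) ∂P = 2 * ∫ θ, g θ ∂P := by
    rw [integral_add hint hint', hflip]; ring
  have hb : ‖∫ θ, (g θ + g (fun k => s k * θ k)) ∂P‖ ≤
      ∫ θ, K * ∑ p ∈ Dtr, net1 n D θ p.1 ^ 2 ∂P := by
    refine norm_integral_le_of_norm_le ?_ (Eventually.of_forall fun θ => ?_)
    · exact (integrable_finsetSum _ fun p _ => gdaux_net_integrable n D p.1).const_mul _
    · simp only [hg, hnet]
      exact gdaux_bound D Dtr (fun p => net1 n D θ p.1) w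
  rw [integral_const_mul, integral_finsetSum _ fun p _ => gdaux_net_integrable n D p.1] at hb
  have hb2 := hb.trans (mul_le_mul_of_nonneg_left
    (Finset.sum_le_sum fun p _ => gdaux_net_integral n D p.1) hK0)
  rw [hsum, norm_mul] at hb2
  have : ‖(2:ℝ)‖ = 2 := by norm_num
  rw [this] at hb2
  linarith [norm_nonneg (∫ θ, g θ ∂P)]
end
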